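/- Let F be a countable class of classifiers and let δ ∈ (0, 1]. Then with probability at least 1 − δ over the i.i.d. n-sample from P, every function f ∈ F satisfies R(f) ≤ R_emp(f) + sqrt((4/n)·(log(2·N(F, 2n)) − log δ)). -/

import Mathlib

open MeasureTheory

/-- The risk of a classifier under the 0-1 loss. Labels `{−1,+1}` are encoded as `Bool`. -/
noncomputable def risk {X : Type*} [MeasurableSpace X] (P : Measure (X × Bool))
    (f : X → Bool) : ℝ :=
  (P {p | f p.1 ≠ p.2}).toReal

/-- The empirical risk of a classifier on a sample of `n` labeled points. -/
noncomputable def empRisk {X : Type*} {n : ℕ} (f : X → Bool) (s : Fin n → X × Bool) : ℝ :=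
  ((Finset.univ.filter fun i => f (s i).1 ≠ (s i).2).card : ℝ) / n

/-- The shattering coefficient `N(F, m)`: the maximum, over all choices of `m` points in `𝒳`,
of the number of distinct label vectors that functions of `F` realize on these points. -/
noncomputable def shatterCoeff {X : Type*} (F : Set (X → Bool)) (m : ℕ) : ℕ :=
  sSup {k : ℕ | ∃ x : Fin m → X,
    k = Set.ncard {v : Fin m → Bool | ∃ f ∈ F, ∀ i, f (x i) = v i}}

open scoped ENNReal

/-- The restrictions of `F` to a finite family of points number at most the shattering
coefficient. -/
theorem ncard_restrictions_le_shatterCoeff {X ι : Type*} [Fintype ι] (F : Set (X → Bool))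
    (x : ι → X) :
    Set.ncard {v : ι → Bool | ∃ f ∈ F, ∀ i, f (x i) = v i} ≤
      shatterCoeff F (Fintype.card ι) := by
  have hbdd : BddAbove {k : ℕ | ∃ y : Fin (Fintype.card ι) → X,
      k = Set.ncard {v : Fin (Fintype.card ι) → Bool | ∃ f ∈ F, ∀ i, f (y i) = v i}} := by
    refine ⟨Nat.card (Fin (Fintype.card ι) → Bool), ?_⟩
    rintro k ⟨y, rfl⟩
    exact Set.ncard_le_card _
  refine le_csSup hbdd ⟨x ∘ (Fintype.equivFin ι).symm, ?_⟩
  let e := Equiv.arrowCongr (Fintype.equivFin ι) (Equiv.refl Bool)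
  rw [← Set.ncard_image_of_injective _ e.injective]
  congr 1
  ext v
  simp only [Set.mem_image, Set.mem_ofPred_eq, Function.comp_apply]
  constructor
  · rintro ⟨u, ⟨f, hf, h⟩, rfl⟩
    exact ⟨f, hf, fun i => h _⟩
  · rintro ⟨f, hf, h⟩
    refine ⟨e.symm v, ⟨f, hf, fun i => ?_⟩, e.apply_symm_apply v⟩
    simpa [e] using h (Fintype.equivFin ι i)

/-- On finitely many points, `F` is represented by at most `shatterCoeff F` functions. -/
theorem exists_finset_representatives {X ι : Type*} [Fintype ι] (F : Set (X → Bool))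
    (x : ι → X) :
    ∃ G : Finset (X → Bool), G.card ≤ shatterCoeff F (Fintype.card ι) ∧
      ∀ f ∈ F, ∃ g ∈ G, ∀ i, g (x i) = f (x i) := by
  classical
  have hrep : ∀ v : ι → Bool, ∃ g : X → Bool,
      (∃ f ∈ F, ∀ i, f (x i) = v i) → ∀ i, g (x i) = v i := fun v => by
    by_cases h : ∃ f ∈ F, ∀ i, f (x i) = v i
    · exact ⟨h.choose, fun _ => h.choose_spec.2⟩
    · exact ⟨fun _ => true, fun h' => (h h').elim⟩
  choose g hg using hrep
  let V := {v : ι → Bool | ∃ f ∈ F, ∀ i, f (x i) = v i}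
  refine ⟨V.toFinset.image g, ?_, fun f hf => ⟨g fun i => f (x i), ?_, ?_⟩⟩
  · refine Finset.card_image_le.trans ?_
    rw [← Set.ncard_eq_toFinset_card']
    exact ncard_restrictions_le_shatterCoeff F x
  · exact Finset.mem_image_of_mem g (Set.mem_toFinset.2 ⟨f, hf, fun _ => rfl⟩)
  · exact hg _ ⟨f, hf, fun _ => rfl⟩

/-- The 0-1 loss of a classifier at a labeled point. -/
noncomputable def zeroOneLoss {X : Type*} (f : X → Bool) (z : X × Bool) : ℝ :=
  if f z.1 ≠ z.2 then 1 else 0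

/-- The difference of the numbers of errors on the second and the first components of a sample of
pairs. -/
noncomputable def errorGap {X : Type*} {n : ℕ} (f : X → Bool)
    (w : Fin n → (X × Bool) × (X × Bool)) : ℝ :=
  ∑ i, (zeroOneLoss f (w i).2 - zeroOneLoss f (w i).1)

/-- Swap the components of a pair if the given bit is set. -/
def condSwap {Z : Type*} (b : Bool) (p : Z × Z) : Z × Z := if b then p.swap else p

theorem zeroOneLoss_nonneg {X : Type*} (f : X → Bool) (z : X × Bool) : 0 ≤ zeroOneLoss f z := by
  unfold zeroOneLoss; split_ifs <;> norm_num

theorem zeroOneLoss_le_one {X : Type*} (f : X → Bool) (z : X × Bool) : zeroOneLoss f z ≤ 1 := by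
  unfold zeroOneLoss; split_ifs <;> norm_num

theorem measurableSet_error {X : Type*} [MeasurableSpace X] {f : X → Bool} (hf : Measurable f) :
    MeasurableSet {p : X × Bool | f p.1 ≠ p.2} :=
  (measurableSet_eq_fun (hf.comp measurable_fst) measurable_snd).compl

theorem measurable_zeroOneLoss {X : Type*} [MeasurableSpace X] {f : X → Bool}
    (hf : Measurable f) : Measurable (zeroOneLoss f) :=
  Measurable.ite (measurableSet_error hf) measurable_const measurable_const

theorem measurable_errorGap {X : Type*} [MeasurableSpace X] {n : ℕ} {f : X → Bool}
    (hf : Measurable f) :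
    Measurable (errorGap f : (Fin n → (X × Bool) × (X × Bool)) → ℝ) := by
  have := measurable_zeroOneLoss hf
  unfold errorGap
  fun_prop

theorem integral_zeroOneLoss {X : Type*} [MeasurableSpace X] (P : Measure (X × Bool))
    {f : X → Bool} (hf : Measurable f) : ∫ z, zeroOneLoss f z ∂P = risk P f := by
  have : zeroOneLoss f = {p : X × Bool | f p.1 ≠ p.2}.indicator 1 := by
    ext z; simp [zeroOneLoss, Set.indicator_apply]
  rw [this, integral_indicator_one (measurableSet_error hf)]
  rfl

theorem natCast_mul_empRisk {X : Type*} {n : ℕ} (hn : 0 < n) (f : X → Bool)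
    (s : Fin n → X × Bool) : n * empRisk f s = ∑ i, zeroOneLoss f (s i) := by
  have : (n : ℝ) ≠ 0 := by positivity
  simp only [empRisk, zeroOneLoss, Finset.sum_boole]
  field_simp

theorem measurable_empRisk {X : Type*} [MeasurableSpace X] {n : ℕ} (hn : 0 < n) {f : X → Bool}
    (hf : Measurable f) : Measurable (empRisk f : (Fin n → X × Bool) → ℝ) := by
  have hn' : (n : ℝ) ≠ 0 := by positivity
  have h := measurable_zeroOneLoss hf
  have : (empRisk f : (Fin n → X × Bool) → ℝ) =
      fun s => (n : ℝ)⁻¹ * ∑ i, zeroOneLoss f (s i) := by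
    ext s
    rw [← natCast_mul_empRisk hn]
    field_simp
  rw [this]
  fun_prop

/-- Hoeffding's bound for the moment generating function of a Rademacher average of the
coordinatewise loss differences. -/
theorem sum_exp_errorGap_condSwap_le {X : Type*} {n : ℕ} (f : X → Bool)
    (w : Fin n → (X × Bool) × (X × Bool)) (t : ℝ) :
    ∑ σ : Fin n → Bool, Real.exp (t * errorGap f fun i => condSwap (σ i) (w i)) ≤
      2 ^ n * Real.exp (n * (t ^ 2 / 2)) := by
  let d : Fin n → Bool → ℝ := fun i b =>
    zeroOneLoss f (condSwap b (w i)).2 - zeroOneLoss f (condSwap b (w i)).1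
  have hexp : ∀ σ : Fin n → Bool, Real.exp (t * errorGap f fun i => condSwap (σ i) (w i)) =
      ∏ i, Real.exp (t * d i (σ i)) := fun σ => by
    rw [errorGap, Finset.mul_sum, Real.exp_sum]
  have hcoord : ∀ i, ∑ b, Real.exp (t * d i b) ≤ 2 * Real.exp (t ^ 2 / 2) := fun i => by
    have hneg : d i true = -d i false := by simp [d, condSwap]
    have hd : d i false ^ 2 ≤ 1 := by
      rw [sq_le_one_iff_abs_le_one, abs_le]
      have h₁ := zeroOneLoss_nonneg f (w i).1
      have h₂ := zeroOneLoss_le_one f (w i).1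
      have h₃ := zeroOneLoss_nonneg f (w i).2
      have h₄ := zeroOneLoss_le_one f (w i).2
      simp only [d, condSwap, Bool.false_eq_true, if_false]
      constructor <;> linarith
    calc ∑ b, Real.exp (t * d i b) = 2 * Real.cosh (t * d i false) := by
          rw [Fintype.sum_bool, hneg, Real.cosh_eq, mul_neg]; ring
      _ ≤ 2 * Real.exp ((t * d i false) ^ 2 / 2) := by
          gcongr; exact Real.cosh_le_exp_half_sq _
      _ ≤ 2 * Real.exp (t ^ 2 / 2) := by
          have h : (t * d i false) ^ 2 ≤ t ^ 2 := by
            rw [mul_pow]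
            exact mul_le_of_le_one_right (sq_nonneg t) hd
          have := Real.exp_le_exp.2 (div_le_div_of_nonneg_right h zero_le_two)
          linarith
  calc ∑ σ : Fin n → Bool, Real.exp (t * errorGap f fun i => condSwap (σ i) (w i))
      = ∏ i, ∑ b, Real.exp (t * d i b) := by
        simp_rw [hexp]; rw [Fintype.prod_sum]
    _ ≤ ∏ _i : Fin n, 2 * Real.exp (t ^ 2 / 2) :=
        Finset.prod_le_prod (fun i _ => Finset.sum_nonneg fun _ _ => (Real.exp_pos _).le)
          fun i _ => hcoord i
    _ = 2 ^ n * Real.exp (n * (t ^ 2 / 2)) := by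
        rw [Finset.prod_const, Finset.card_univ, Fintype.card_fin, mul_pow, ← Real.exp_nat_mul]

theorem measurePreserving_condSwap {Z : Type*} [MeasurableSpace Z] (P : Measure Z) [SFinite P]
    (b : Bool) : MeasurePreserving (condSwap b) (P.prod P) (P.prod P) := by
  cases b
  · exact MeasurePreserving.id _
  · exact Measure.measurePreserving_swap

/-- The supremum over `F` of the exponential moments of the error gap. -/
noncomputable def supExpGap {X : Type*} {n : ℕ} (F : Set (X → Bool)) (t : ℝ)
    (w : Fin n → (X × Bool) × (X × Bool)) : ℝ≥0∞ :=
  ⨆ f ∈ F, ENNReal.ofReal (Real.exp (t * errorGap f w))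

theorem measurable_supExpGap {X : Type*} [MeasurableSpace X] {n : ℕ} {F : Set (X → Bool)}
    (hFc : F.Countable) (hFmeas : ∀ f ∈ F, Measurable f) (t : ℝ) :
    Measurable (supExpGap F t : (Fin n → (X × Bool) × (X × Bool)) → ℝ≥0∞) :=
  Measurable.biSup F hFc fun f hf =>
    ENNReal.measurable_ofReal.comp
      (Real.measurable_exp.comp ((measurable_errorGap (hFmeas f hf)).const_mul t))

theorem sum_supExpGap_condSwap_le {X : Type*} {n : ℕ} (F : Set (X → Bool)) (t : ℝ)
    (w : Fin n → (X × Bool) × (X × Bool)) :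
    ∑ σ : Fin n → Bool, supExpGap F t (fun i => condSwap (σ i) (w i)) ≤
      shatterCoeff F (2 * n) * ENNReal.ofReal (2 ^ n * Real.exp (n * (t ^ 2 / 2))) := by
  obtain ⟨G, hcard, hG⟩ := exists_finset_representatives F
    (Sum.elim (fun i => (w i).1.1) (fun i => (w i).2.1) : Fin n ⊕ Fin n → X)
  rw [Fintype.card_sum, Fintype.card_fin, ← two_mul] at hcard
  have hsup : ∀ σ : Fin n → Bool, supExpGap F t (fun i => condSwap (σ i) (w i)) ≤
      ∑ g ∈ G, ENNReal.ofReal (Real.exp (t * errorGap g fun i => condSwap (σ i) (w i))) := by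
    intro σ
    refine iSup₂_le fun f hf => ?_
    obtain ⟨g, hgG, hg⟩ := hG f hf
    have h₁ : ∀ i, g (w i).1.1 = f (w i).1.1 := fun i => hg (Sum.inl i)
    have h₂ : ∀ i, g (w i).2.1 = f (w i).2.1 := fun i => hg (Sum.inr i)
    have : errorGap f (fun i => condSwap (σ i) (w i)) =
        errorGap g fun i => condSwap (σ i) (w i) := by
      refine Finset.sum_congr rfl fun i _ => ?_
      simp only [condSwap, zeroOneLoss]
      split_ifs with hσ <;> simp_all
    rw [this]
    exact Finset.single_le_sum
      (f := fun g => ENNReal.ofReal (Real.exp (t * errorGap g fun i => condSwap (σ i) (w i))))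
      (fun _ _ => zero_le) hgG
  calc ∑ σ : Fin n → Bool, supExpGap F t (fun i => condSwap (σ i) (w i))
      ≤ ∑ σ : Fin n → Bool, ∑ g ∈ G,
          ENNReal.ofReal (Real.exp (t * errorGap g fun i => condSwap (σ i) (w i))) :=
        Finset.sum_le_sum fun σ _ => hsup σ
    _ = ∑ g ∈ G, ENNReal.ofReal
          (∑ σ : Fin n → Bool, Real.exp (t * errorGap g fun i => condSwap (σ i) (w i))) := by
        rw [Finset.sum_comm]
        refine Finset.sum_congr rfl fun g _ => ?_
        rw [ENNReal.ofReal_sum_of_nonneg fun _ _ => (Real.exp_pos _).le]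
    _ ≤ ∑ _g ∈ G, ENNReal.ofReal (2 ^ n * Real.exp (n * (t ^ 2 / 2))) :=
        Finset.sum_le_sum fun g _ =>
          ENNReal.ofReal_le_ofReal (sum_exp_errorGap_condSwap_le g w t)
    _ ≤ shatterCoeff F (2 * n) * ENNReal.ofReal (2 ^ n * Real.exp (n * (t ^ 2 / 2))) := by
        rw [Finset.sum_const, nsmul_eq_mul]
        gcongr

/-- Symmetrization: the exponential moment of the largest error gap is controlled by the
shattering coefficient. -/
theorem lintegral_supExpGap_le {X : Type*} [MeasurableSpace X] (P : Measure (X × Bool))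
    [IsProbabilityMeasure P] {n : ℕ} {F : Set (X → Bool)} (hFc : F.Countable)
    (hFmeas : ∀ f ∈ F, Measurable f) (t : ℝ) :
    ∫⁻ w, supExpGap F t w ∂(Measure.pi fun _ : Fin n => P.prod P) ≤
      shatterCoeff F (2 * n) * ENNReal.ofReal (Real.exp (n * (t ^ 2 / 2))) := by
  have hmeas := measurable_supExpGap (n := n) hFc hFmeas t
  have hpres : ∀ σ : Fin n → Bool, MeasurePreserving
      (fun (w : Fin n → (X × Bool) × (X × Bool)) i => condSwap (σ i) (w i))
      (Measure.pi fun _ : Fin n => P.prod P) (Measure.pi fun _ : Fin n => P.prod P) :=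
    fun σ => measurePreserving_pi _ _ fun i => measurePreserving_condSwap P (σ i)
  have key : (2 : ℝ≥0∞) ^ n *
      ∫⁻ w, supExpGap F t w ∂(Measure.pi fun _ : Fin n => P.prod P) ≤
      2 ^ n * (shatterCoeff F (2 * n) * ENNReal.ofReal (Real.exp (n * (t ^ 2 / 2)))) :=
    calc (2 : ℝ≥0∞) ^ n * ∫⁻ w, supExpGap F t w ∂(Measure.pi fun _ : Fin n => P.prod P)
        = ∑ σ : Fin n → Bool, ∫⁻ w, supExpGap F t (fun i => condSwap (σ i) (w i))
            ∂(Measure.pi fun _ : Fin n => P.prod P) := by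
          simp_rw [fun σ => (hpres σ).lintegral_comp hmeas]
          simp
      _ = ∫⁻ w, ∑ σ : Fin n → Bool, supExpGap F t (fun i => condSwap (σ i) (w i))
            ∂(Measure.pi fun _ : Fin n => P.prod P) :=
          (lintegral_finsetSum _ fun σ _ => hmeas.comp (hpres σ).measurable).symm
      _ ≤ ∫⁻ _, shatterCoeff F (2 * n) * ENNReal.ofReal (2 ^ n * Real.exp (n * (t ^ 2 / 2)))
            ∂(Measure.pi fun _ : Fin n => P.prod P) :=
          lintegral_mono fun w => sum_supExpGap_condSwap_le F t w
      _ = 2 ^ n * (shatterCoeff F (2 * n) * ENNReal.ofReal (Real.exp (n * (t ^ 2 / 2)))) := by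
          rw [lintegral_const, measure_univ, mul_one, ENNReal.ofReal_mul (by positivity),
            ENNReal.ofReal_pow (by norm_num), ENNReal.ofReal_ofNat]
          ring
  exact (ENNReal.mul_le_mul_iff_right (by positivity) (by finiteness)).1 key

/-- Averaging over a ghost sample, by Jensen's inequality. -/
theorem ofReal_exp_le_lintegral_supExpGap {X : Type*} [MeasurableSpace X]
    (P : Measure (X × Bool)) [IsProbabilityMeasure P] {n : ℕ} (hn : 0 < n) {F : Set (X → Bool)}
    {f : X → Bool} (hf : f ∈ F) (hfm : Measurable f) (t : ℝ) (s : Fin n → X × Bool) :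
    ENNReal.ofReal (Real.exp (t * (n * (risk P f - empRisk f s)))) ≤
      ∫⁻ s', supExpGap F t (fun i => (s i, s' i)) ∂(Measure.pi fun _ : Fin n => P) := by
  let Y : (Fin n → X × Bool) → ℝ := fun s' => t * errorGap f fun i => (s i, s' i)
  have hYm : Measurable Y :=
    ((measurable_errorGap hfm).comp (by fun_prop)).const_mul t
  have hgap : ∀ s' : Fin n → X × Bool, |errorGap f fun i => (s i, s' i)| ≤ n := fun s' => by
    refine (Finset.abs_sum_le_sum_abs _ _).trans ?_
    refine (Finset.sum_le_card_nsmul _ _ 1 fun i _ => ?_).trans (by simp)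
    have h₁ := zeroOneLoss_nonneg f (s i)
    have h₂ := zeroOneLoss_le_one f (s i)
    have h₃ := zeroOneLoss_nonneg f (s' i)
    have h₄ := zeroOneLoss_le_one f (s' i)
    rw [abs_le]
    constructor <;> linarith
  have hYb : ∀ s', |Y s'| ≤ |t| * n := fun s' => by
    rw [abs_mul]
    exact mul_le_mul_of_nonneg_left (hgap s') (abs_nonneg t)
  have hYint : Integrable Y (Measure.pi fun _ : Fin n => P) :=
    Integrable.of_bound hYm.aestronglyMeasurable (|t| * n) (ae_of_all _ hYb)
  have hexpint : Integrable (fun s' => Real.exp (Y s')) (Measure.pi fun _ : Fin n => P) := by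
    refine Integrable.of_bound hYm.exp.aestronglyMeasurable (Real.exp (|t| * n))
      (ae_of_all _ fun s' => ?_)
    rw [Real.norm_eq_abs, Real.abs_exp]
    exact Real.exp_le_exp.2 ((le_abs_self _).trans (hYb s'))
  have hloss : Integrable (zeroOneLoss f) P :=
    Integrable.of_bound (measurable_zeroOneLoss hfm).aestronglyMeasurable 1
      (ae_of_all _ fun z => by
        rw [Real.norm_eq_abs, abs_of_nonneg (zeroOneLoss_nonneg f z)]
        exact zeroOneLoss_le_one f z)
  have hlossi : ∀ i, Integrable (fun s' : Fin n → X × Bool => zeroOneLoss f (s' i))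
      (Measure.pi fun _ : Fin n => P) := fun i =>
    (measurePreserving_eval (fun _ : Fin n => P) i).integrable_comp_of_integrable hloss
  have hmean : ∫ s', Y s' ∂(Measure.pi fun _ : Fin n => P) =
      t * (n * (risk P f - empRisk f s)) := by
    simp only [Y, errorGap]
    have hdiff : ∀ i ∈ Finset.univ, Integrable
        (fun s' : Fin n → X × Bool => zeroOneLoss f (s' i) - zeroOneLoss f (s i))
        (Measure.pi fun _ : Fin n => P) := fun i _ => (hlossi i).sub (integrable_const _)
    rw [integral_const_mul, integral_finsetSum _ hdiff, mul_sub, natCast_mul_empRisk hn]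
    have : ∀ i, ∫ s' : Fin n → X × Bool, (zeroOneLoss f (s' i) - zeroOneLoss f (s i))
        ∂(Measure.pi fun _ : Fin n => P) = risk P f - zeroOneLoss f (s i) := fun i => by
      rw [integral_sub (hlossi i) (integrable_const _),
        integral_comp_eval (μ := fun _ : Fin n => P) hloss.aestronglyMeasurable,
        integral_zeroOneLoss P hfm]
      simp
    simp [this]
  calc ENNReal.ofReal (Real.exp (t * (n * (risk P f - empRisk f s))))
      ≤ ENNReal.ofReal (∫ s', Real.exp (Y s') ∂(Measure.pi fun _ : Fin n => P)) := by
        rw [← hmean]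
        exact ENNReal.ofReal_le_ofReal (convexOn_exp.map_integral_le
          Real.continuous_exp.continuousOn isClosed_univ (by simp) hYint hexpint)
    _ = ∫⁻ s', ENNReal.ofReal (Real.exp (Y s')) ∂(Measure.pi fun _ : Fin n => P) :=
        ofReal_integral_eq_lintegral_ofReal hexpint (ae_of_all _ fun _ => (Real.exp_pos _).le)
    _ ≤ ∫⁻ s', supExpGap F t (fun i => (s i, s' i)) ∂(Measure.pi fun _ : Fin n => P) :=
        lintegral_mono fun s' => le_iSup₂_of_le f hf le_rfl

/-- The one-sided uniform deviation bound via the shattering coefficient. -/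
theorem measure_exists_risk_gt_le {X : Type*} [MeasurableSpace X]
    (P : Measure (X × Bool)) [IsProbabilityMeasure P]
    {F : Set (X → Bool)} (hFc : F.Countable) (hFmeas : ∀ f ∈ F, Measurable f)
    {n : ℕ} (hn : 0 < n) {ε : ℝ} (hε : 0 ≤ ε) :
    (Measure.pi fun _ : Fin n => P) {s | ∃ f ∈ F, empRisk f s + ε < risk P f} ≤
      ENNReal.ofReal (shatterCoeff F (2 * n) * Real.exp (-(n * ε ^ 2 / 2))) := by
  let A : (Fin n → X × Bool) → ℝ≥0∞ := fun s =>
    ∫⁻ s', supExpGap F ε (fun i => (s i, s' i)) ∂(Measure.pi fun _ : Fin n => P)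
  let e := MeasurableEquiv.arrowProdEquivProdArrow (X × Bool) (X × Bool) (Fin n)
  have hm := (measurable_supExpGap (n := n) hFc hFmeas ε).comp e.symm.measurable
  have hA : Measurable A := hm.lintegral_prod_right'
  have hAint : ∫⁻ s, A s ∂(Measure.pi fun _ : Fin n => P) =
      ∫⁻ w, supExpGap F ε w ∂(Measure.pi fun _ : Fin n => P.prod P) := by
    have h := (measurePreserving_arrowProdEquivProdArrow (X × Bool) (X × Bool) (Fin n)
      (fun _ => P) (fun _ => P)).lintegral_comp hm
    rw [lintegral_prod _ hm.aemeasurable] at h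
    exact h.symm
  have hsub : {s : Fin n → X × Bool | ∃ f ∈ F, empRisk f s + ε < risk P f} ⊆
      {s | ENNReal.ofReal (Real.exp (n * ε ^ 2)) ≤ A s} := by
    rintro s ⟨f, hf, hlt⟩
    refine le_trans (ENNReal.ofReal_le_ofReal (Real.exp_le_exp.2 ?_))
      (ofReal_exp_le_lintegral_supExpGap P hn hf (hFmeas f hf) ε s)
    calc (n : ℝ) * ε ^ 2 = ε * (n * ε) := by ring
      _ ≤ ε * (n * (risk P f - empRisk f s)) := by
        gcongr
        linarith
  have hmarkov := (mul_meas_ge_le_lintegral (μ := Measure.pi fun _ : Fin n => P) hA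
    (ENNReal.ofReal (Real.exp (n * ε ^ 2)))).trans
      (hAint.trans_le (lintegral_supExpGap_le P hFc hFmeas ε))
  refine (measure_mono hsub).trans ?_
  have hpos : ENNReal.ofReal (Real.exp (n * ε ^ 2)) ≠ 0 :=
    (ENNReal.ofReal_pos.2 (Real.exp_pos _)).ne'
  refine (ENNReal.mul_le_mul_iff_right hpos ENNReal.ofReal_ne_top).1 (hmarkov.trans_eq ?_)
  rw [← ENNReal.ofReal_natCast, ← ENNReal.ofReal_mul (by positivity),
    ← ENNReal.ofReal_mul (by positivity), mul_left_comm, ← Real.exp_add]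
  ring_nf

theorem one_le_shatterCoeff {X : Type*} [Nonempty X] {F : Set (X → Bool)} (hF : F.Nonempty)
    (m : ℕ) : 1 ≤ shatterCoeff F m := by
  obtain ⟨f, hf⟩ := hF
  let x : Fin m → X := fun _ => Classical.arbitrary X
  have h := ncard_restrictions_le_shatterCoeff F x
  rw [Fintype.card_fin] at h
  refine le_trans ?_ h
  exact (Set.ncard_pos).2 ⟨fun i => f (x i), f, hf, fun _ => rfl⟩

/-- **Generalization bound via the shattering coefficient.** For a countable class `F` of
classifiers and every `δ ∈ (0,1]`, with probability at least `1 − δ` over the i.i.d. `n`-sample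
from `P`, every `f ∈ F` satisfies
`R(f) ≤ R_emp(f) + sqrt((4/n) (log(2 N(F, 2n)) − log δ))`. -/
theorem shattering_generalization_bound {X : Type*} [MeasurableSpace X]
    (P : Measure (X × Bool)) [IsProbabilityMeasure P]
    (F : Set (X → Bool)) (hFc : F.Countable) (hFmeas : ∀ f ∈ F, Measurable f)
    (n : ℕ) (hn : 0 < n) (δ : ℝ) (hδ0 : 0 < δ) (hδ1 : δ ≤ 1) :
    1 - δ ≤ ((Measure.pi fun _ : Fin n => P)
        {s | ∀ f ∈ F, risk P f ≤ empRisk f s +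
            Real.sqrt ((4 / n) * (Real.log (2 * shatterCoeff F (2 * n)) - Real.log δ))}).toReal := by
  have hX : Nonempty X := (nonempty_of_isProbabilityMeasure P).map Prod.fst
  set ε := Real.sqrt ((4 / n) * (Real.log (2 * shatterCoeff F (2 * n)) - Real.log δ)) with hε
  set S := {s : Fin n → X × Bool | ∀ f ∈ F, risk P f ≤ empRisk f s + ε} with hS
  have hSm : MeasurableSet S := by
    rw [hS, Set.ofPred_forall]
    simp_rw [Set.ofPred_forall]
    exact MeasurableSet.biInter hFc fun f hf =>
      measurableSet_le measurable_const ((measurable_empRisk hn (hFmeas f hf)).add_const ε)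
  have hcompl : Sᶜ = {s | ∃ f ∈ F, empRisk f s + ε < risk P f} := by
    ext s
    simp [hS]
  suffices hbad : (Measure.pi fun _ : Fin n => P).real Sᶜ ≤ δ by
    have h := probReal_compl_eq_one_sub (μ := Measure.pi fun _ : Fin n => P) hSm
    change 1 - δ ≤ (Measure.pi fun _ : Fin n => P).real S
    linarith
  rcases F.eq_empty_or_nonempty with hF | hF
  · rw [hcompl]
    simp [hF, hδ0.le]
  have hN : (1 : ℝ) ≤ shatterCoeff F (2 * n) := by
    exact_mod_cast one_le_shatterCoeff hF (2 * n)
  set N : ℝ := (shatterCoeff F (2 * n) : ℝ)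
  have hn' : (0 : ℝ) < n := by exact_mod_cast hn
  have hlog : Real.log (2 * N) - Real.log δ = Real.log (2 * N / δ) :=
    (Real.log_div (by positivity) hδ0.ne').symm
  have hratio : 1 ≤ 2 * N / δ := by
    rw [le_div_iff₀ hδ0]
    linarith
  have hexp : n * ε ^ 2 / 2 = 2 * Real.log (2 * N / δ) := by
    rw [hε, hlog, Real.sq_sqrt (mul_nonneg (by positivity) (Real.log_nonneg hratio))]
    field_simp
    ring
  have hbound : N * Real.exp (-(n * ε ^ 2 / 2)) ≤ δ := by
    have : Real.exp (2 * Real.log (2 * N / δ)) = (2 * N / δ) ^ 2 := by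
      rw [two_mul, Real.exp_add, Real.exp_log (by positivity)]
      ring
    rw [hexp, Real.exp_neg, this, ← div_eq_mul_inv, div_le_iff₀ (by positivity)]
    calc N ≤ 2 * N := by linarith
      _ = δ * (2 * N / δ) := by field_simp
      _ ≤ δ * (2 * N / δ) ^ 2 := by
        gcongr
        exact le_self_pow₀ hratio two_ne_zero
  rw [hcompl]
  exact ENNReal.toReal_le_of_le_ofReal hδ0.le
    ((measure_exists_risk_gt_le P hFc hFmeas hn (Real.sqrt_nonneg _)).trans
      (ENNReal.ofReal_le_ofReal hbound))
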